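/- arXiv:1403.8141 — 2 statements merged into one kernel-verified Lean document; each statement's English description precedes it below -/
import Mathlib

section
/- Let R₂ be the quotient of the polynomial ring Λ₂[U,V] by the ideal generated by U² − e^{−δ₁} and V² − e^{−δ₂}, with u, v the images of U, V, and set Ψ_s = (u+v)·e^{(1/2+h)δ₁−hδ₂}. Then for every integer p ≥ 1, Ψ_s^{2p} = K^p·( (Σ_{i=0}^{⌊p/2⌋} C(p,2i)·α^{p−2i}·(xy)^i)·1 + (Σ_{i=0}^{⌊(p−1)/2⌋} C(p,2i+1)·α^{p−2i−1}·(xy)^i)·(u·v) ), where C(p,k) denotes the binomial coefficient. -/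
/- Λ₂ is the group algebra of ℝ² over ℝ; E β = e^β, δ i the standard basis.
   R₂ = Λ₂[U,V]/(U²−e^{−δ₁}, V²−e^{−δ₂}) is the Künneth model of
   QH_*(S²×S², ω₀⊕λω₀) over the Novikov ring; u, v are the images of U, V. -/

noncomputable section

abbrev Λ₂ : Type := AddMonoidAlgebra ℝ (Fin 2 → ℝ)

def E (β : Fin 2 → ℝ) : Λ₂ := AddMonoidAlgebra.single β 1

def δ (i : Fin 2) : Fin 2 → ℝ := Pi.single i 1

def x : Λ₂ := E (-δ 0)
def y : Λ₂ := E (-δ 1)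
def α : Λ₂ := (1 / 2 : ℝ) • (x + y)
def K (h : ℝ) : Λ₂ := 2 * E ((1 + 2 * h) • δ 0 - (2 * h) • δ 1)

def rRel : Ideal (MvPolynomial (Fin 2) Λ₂) :=
  Ideal.span {MvPolynomial.X 0 ^ 2 - MvPolynomial.C (E (-δ 0)),
              MvPolynomial.X 1 ^ 2 - MvPolynomial.C (E (-δ 1))}

abbrev R₂ : Type := MvPolynomial (Fin 2) Λ₂ ⧸ rRel

def u : R₂ := Ideal.Quotient.mk rRel (MvPolynomial.X 0)
def v : R₂ := Ideal.Quotient.mk rRel (MvPolynomial.X 1)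

def eR (β : Fin 2 → ℝ) : R₂ := algebraMap Λ₂ R₂ (E β)

/-- Ψ_s = (u+v)·e^{(1/2+h)δ₁−hδ₂}, the Seidel element of the infinite-order loop s. -/
def Ψs (h : ℝ) : R₂ := (u + v) * eR ((1 / 2 + h) • δ 0 - h • δ 1)

theorem sum_range_eq_sum_even_add_sum_odd {M : Type*} [AddCommMonoid M] (f : ℕ → M) (n : ℕ) :
    ∑ k ∈ Finset.range n, f k =
      ∑ i ∈ Finset.range ((n + 1) / 2), f (2 * i) +
        ∑ i ∈ Finset.range (n / 2), f (2 * i + 1) := by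
  induction n with
  | zero => simp
  | succ n ih =>
    rw [Finset.sum_range_succ, ih]
    obtain ⟨m, rfl | rfl⟩ := Nat.even_or_odd' n
    · rw [show (2 * m + 1 + 1) / 2 = m + 1 by omega, show (2 * m + 1) / 2 = m by omega,
        show 2 * m / 2 = m by omega, Finset.sum_range_succ]
      abel
    · rw [show (2 * m + 1 + 1 + 1) / 2 = m + 1 by omega,
        show (2 * m + 1 + 1) / 2 = m + 1 by omega, show (2 * m + 1) / 2 = m by omega,
        Finset.sum_range_succ (fun i => f (2 * i + 1)) m]
      abel

theorem add_pow_of_sq_eq {R : Type*} [CommSemiring R] {a w z : R} (hw : w ^ 2 = z) {p : ℕ}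
    (hp : 1 ≤ p) :
    (a + w) ^ p =
      ∑ i ∈ Finset.range (p / 2 + 1), (p.choose (2 * i) : R) * a ^ (p - 2 * i) * z ^ i +
        (∑ i ∈ Finset.range ((p - 1) / 2 + 1),
          (p.choose (2 * i + 1) : R) * a ^ (p - 2 * i - 1) * z ^ i) * w := by
  rw [add_comm a w, add_pow, sum_range_eq_sum_even_add_sum_odd,
    show (p + 1 + 1) / 2 = p / 2 + 1 by omega, show (p + 1) / 2 = (p - 1) / 2 + 1 by omega,
    Finset.sum_mul]
  congr 1
  · refine Finset.sum_congr rfl fun i _ => ?_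
    rw [pow_mul, hw]
    ring
  · refine Finset.sum_congr rfl fun i _ => ?_
    rw [pow_succ, pow_mul, hw, Nat.sub_sub]
    ring

theorem pow_two_mul_of_sq_eq_map_mul {A S : Type*} [CommSemiring A] [CommSemiring S] [Algebra A S]
    {k a z : A} {w s : S} (hs : s ^ 2 = algebraMap A S k * (algebraMap A S a + w))
    (hw : w ^ 2 = algebraMap A S z) {p : ℕ} (hp : 1 ≤ p) :
    s ^ (2 * p) =
      algebraMap A S (k ^ p) *
        (algebraMap A S (∑ i ∈ Finset.range (p / 2 + 1),
            (p.choose (2 * i) : A) * a ^ (p - 2 * i) * z ^ i) * 1 +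
         algebraMap A S (∑ i ∈ Finset.range ((p - 1) / 2 + 1),
            (p.choose (2 * i + 1) : A) * a ^ (p - 2 * i - 1) * z ^ i) * w) := by
  rw [pow_mul, hs, mul_pow, add_pow_of_sq_eq hw hp, map_pow, mul_one]
  simp only [map_sum, map_mul, map_pow, map_natCast]

theorem E_mul_E (β γ : Fin 2 → ℝ) : E β * E γ = E (β + γ) := by
  simp [E, AddMonoidAlgebra.single_mul_single]

theorem u_sq : u ^ 2 = algebraMap Λ₂ R₂ x :=
  Ideal.Quotient.eq.mpr (Ideal.subset_span (Set.mem_insert _ _))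

theorem v_sq : v ^ 2 = algebraMap Λ₂ R₂ y :=
  Ideal.Quotient.eq.mpr (Ideal.subset_span (Set.mem_insert_of_mem _ rfl))

theorem two_mul_α : 2 * α = x + y := by
  rw [α, two_mul, ← add_smul]
  norm_num

theorem Ψs_sq (h : ℝ) :
    Ψs h ^ 2 = algebraMap Λ₂ R₂ (K h) * (algebraMap Λ₂ R₂ α + u * v) := by
  have hE : E ((1 / 2 + h) • δ 0 - h • δ 1) * E ((1 / 2 + h) • δ 0 - h • δ 1) =
      E ((1 + 2 * h) • δ 0 - (2 * h) • δ 1) := by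
    rw [E_mul_E]
    congr 1
    module
  have hα : 2 * algebraMap Λ₂ R₂ α = u ^ 2 + v ^ 2 := by
    rw [u_sq, v_sq, ← map_add, ← two_mul_α, map_mul, map_ofNat]
  rw [Ψs, eR, K, ← hE, map_mul, map_mul, map_ofNat]
  linear_combination -(algebraMap Λ₂ R₂ (E ((1 / 2 + h) • δ 0 - h • δ 1))) ^ 2 * hα

/-- The explicit formula for Ψ_s^{2p} = K^p(A + αB)^p. -/
theorem psi_s_even_power_formula
    (lam : ℝ) (hlam : 1 < lam) (h : ℝ) (hh : h = 1 / (6 * lam * (lam - 1)))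
    (p : ℕ) (hp : 1 ≤ p) :
    Ψs h ^ (2 * p) =
      algebraMap Λ₂ R₂ (K h ^ p) *
        (algebraMap Λ₂ R₂ (∑ i ∈ Finset.range (p / 2 + 1),
            (p.choose (2 * i) : Λ₂) * α ^ (p - 2 * i) * (x * y) ^ i) * 1 +
         algebraMap Λ₂ R₂ (∑ i ∈ Finset.range ((p - 1) / 2 + 1),
            (p.choose (2 * i + 1) : Λ₂) * α ^ (p - 2 * i - 1) * (x * y) ^ i) * (u * v)) := by
  have hw : (u * v) ^ 2 = algebraMap Λ₂ R₂ (x * y) := by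
    rw [map_mul, ← u_sq, ← v_sq]
    ring
  exact pow_two_mul_of_sq_eq_map_mul (A := Λ₂) (S := R₂) (Ψs_sq h) hw hp

end
end

section
/- Let R̄₂ be the quotient of the polynomial ring Λ₂[Ū,V̄] by the ideal generated by Ū² − e^{δ₁} and V̄² − e^{δ₂}, with ū, v̄ the images of Ū, V̄, and set Ψ̄ = −(ū+v̄)·e^{−(1/2+h)δ₁+hδ₂}. Then for every integer q ≥ 1, Ψ̄^{2q} = 4^q·K^{−q}·( (Σ_{i=0}^{⌊q/2⌋} C(q,2i)·α^{q−2i}·(xy)^{i−q})·1 + (Σ_{i=0}^{⌊(q−1)/2⌋} C(q,2i+1)·α^{q−2i−1}·(xy)^{i+1−q})·(ū·v̄) ), where negative powers of the units K and xy are powers of their inverses, and C(q,k) denotes the binomial coefficient. -/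
/- Λ₂ is the group algebra of ℝ² over ℝ; E β = e^β, δ i the standard basis.
   R̄₂ = Λ₂[Ū,V̄]/(Ū²−e^{δ₁}, V̄²−e^{δ₂}) is the Künneth model of
   QH_*(S²×S², −(ω₀⊕λω₀)); ub, vb are the images of Ū, V̄.  Negative powers
   of the units K and xy are expressed through elements Kinv, xyInv inverse
   to K and x·y. -/

noncomputable section

def rbRel : Ideal (MvPolynomial (Fin 2) Λ₂) :=
  Ideal.span {MvPolynomial.X 0 ^ 2 - MvPolynomial.C (E (δ 0)),
              MvPolynomial.X 1 ^ 2 - MvPolynomial.C (E (δ 1))}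

abbrev Rb₂ : Type := MvPolynomial (Fin 2) Λ₂ ⧸ rbRel

def ub : Rb₂ := Ideal.Quotient.mk rbRel (MvPolynomial.X 0)
def vb : Rb₂ := Ideal.Quotient.mk rbRel (MvPolynomial.X 1)

def eRb (β : Fin 2 → ℝ) : Rb₂ := algebraMap Λ₂ Rb₂ (E β)

/-- Ψ̄ = −(ū+v̄)·e^{−(1/2+h)δ₁+hδ₂}, the Seidel element Ψ_{τ(s)} of the reversed loop. -/
def Ψb (h : ℝ) : Rb₂ := -((ub + vb) * eRb (-((1 / 2 + h) • δ 0) + h • δ 1))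

theorem sum_range_succ_even_odd {M : Type*} [AddCommMonoid M] (f : ℕ → M) (q : ℕ) :
    ∑ k ∈ Finset.range (q + 1), f k =
      ∑ i ∈ Finset.range (q / 2 + 1), f (2 * i) +
        ∑ i ∈ Finset.range ((q + 1) / 2), f (2 * i + 1) := by
  induction q with
  | zero => simp
  | succ n ih =>
    rw [Finset.sum_range_succ, ih]
    rcases Nat.even_or_odd' n with ⟨m, rfl | rfl⟩
    · rw [show (2 * m + 1 + 1) / 2 = m + 1 by omega, show (2 * m + 1) / 2 = m by omega,
        show 2 * m / 2 = m by omega, Finset.sum_range_succ (fun i => f (2 * i + 1)), add_assoc]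
    · rw [show (2 * m + 1 + 1 + 1) / 2 = m + 1 by omega,
        show (2 * m + 1 + 1) / 2 = m + 1 by omega, show (2 * m + 1) / 2 = m by omega,
        Finset.sum_range_succ (fun i => f (2 * i)) (m + 1), add_right_comm,
        show 2 * (m + 1) = 2 * m + 1 + 1 by ring]

theorem add_pow_even_odd {A B : Type*} [CommRing A] [CommRing B] [Algebra A B]
    {a p s : A} {w : B} (hps : p * s = 1) (hw : w ^ 2 = algebraMap A B s)
    {q : ℕ} (hq : 1 ≤ q) :
    (algebraMap A B (a * s) + w) ^ q =
      algebraMap A B (∑ i ∈ Finset.range (q / 2 + 1),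
          (q.choose (2 * i) : A) * a ^ (q - 2 * i) * (p ^ i * s ^ q)) +
        algebraMap A B (∑ i ∈ Finset.range ((q - 1) / 2 + 1),
          (q.choose (2 * i + 1) : A) * a ^ (q - 2 * i - 1) * (p ^ (i + 1) * s ^ q)) * w := by
  have hcancel (j k : ℕ) : p ^ j * s ^ (j + k) = s ^ k := by
    rw [pow_add, ← mul_assoc, ← mul_pow, hps, one_pow, one_mul]
  rw [add_comm, add_pow, sum_range_succ_even_odd, map_sum, map_sum, Finset.sum_mul,
    show (q - 1) / 2 + 1 = (q + 1) / 2 by omega]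
  congr 1 <;> refine Finset.sum_congr rfl fun i hi => ?_ <;> rw [Finset.mem_range] at hi
  · obtain ⟨r, rfl⟩ := Nat.exists_eq_add_of_le (show 2 * i ≤ q by omega)
    rw [Nat.add_sub_cancel_left, show s ^ (2 * i + r) = s ^ (i + (i + r)) by ring, hcancel,
      pow_mul, hw]
    simp only [map_mul, map_pow, map_natCast]
    ring
  · obtain ⟨r, rfl⟩ := Nat.exists_eq_add_of_le (show 2 * i + 1 ≤ q by omega)
    rw [Nat.add_sub_cancel_left, show 2 * i + 1 + r - 2 * i - 1 = r by omega,
      show s ^ (2 * i + 1 + r) = s ^ (i + 1 + (i + r)) by ring, hcancel, pow_succ, pow_mul, hw]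
    simp only [map_mul, map_pow, map_natCast]
    ring

theorem E_add (β γ : Fin 2 → ℝ) : E (β + γ) = E β * E γ := by
  simp [E, AddMonoidAlgebra.single_mul_single]

theorem E_zero : E 0 = 1 := rfl

theorem ub_sq : ub ^ 2 = algebraMap Λ₂ Rb₂ (E (δ 0)) :=
  (Ideal.Quotient.mk_eq_mk_iff_sub_mem _ _).2 (Ideal.subset_span (by simp))

theorem vb_sq : vb ^ 2 = algebraMap Λ₂ Rb₂ (E (δ 1)) :=
  (Ideal.Quotient.mk_eq_mk_iff_sub_mem _ _).2 (Ideal.subset_span (by simp))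

theorem E_δ_zero_mul_x : E (δ 0) * x = 1 := by
  rw [x, ← E_add, add_neg_cancel, E_zero]

theorem E_δ_one_mul_y : E (δ 1) * y = 1 := by
  rw [y, ← E_add, add_neg_cancel, E_zero]

theorem eq_E_mul_E_of_mul_eq_one {s : Λ₂} (hs : x * y * s = 1) : s = E (δ 0) * E (δ 1) := by
  linear_combination (E (δ 0) * E (δ 1)) * hs - s * (E (δ 1) * y) * E_δ_zero_mul_x
    - s * E_δ_one_mul_y

theorem two_mul_α_mul {s : Λ₂} (hs : x * y * s = 1) : 2 * (α * s) = E (δ 0) + E (δ 1) := by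
  rw [eq_E_mul_E_of_mul_eq_one hs]
  linear_combination (E (δ 0) * E (δ 1)) * two_mul_α + E (δ 1) * E_δ_zero_mul_x
    + E (δ 0) * E_δ_one_mul_y

theorem E_sq_eq_two_mul {h : ℝ} {Kinv : Λ₂} (hK : K h * Kinv = 1) :
    E (-((1 / 2 + h) • δ 0) + h • δ 1) ^ 2 = 2 * Kinv := by
  have hE : E (-((1 / 2 + h) • δ 0) + h • δ 1) ^ 2 *
      E ((1 + 2 * h) • δ 0 - (2 * h) • δ 1) = 1 := by
    rw [sq, ← E_add, ← E_add, ← E_zero]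
    congr 1
    module
  rw [K] at hK
  linear_combination 2 * Kinv * hE - E (-((1 / 2 + h) • δ 0) + h • δ 1) ^ 2 * hK

theorem Ψb_sq {h : ℝ} {Kinv s : Λ₂} (hK : K h * Kinv = 1) (hs : x * y * s = 1) :
    Ψb h ^ 2 = algebraMap Λ₂ Rb₂ (4 * Kinv) * (algebraMap Λ₂ Rb₂ (α * s) + ub * vb) := by
  have hE := congrArg (algebraMap Λ₂ Rb₂) (E_sq_eq_two_mul hK)
  have hα := congrArg (algebraMap Λ₂ Rb₂) (two_mul_α_mul hs)
  simp only [map_mul, map_pow, map_add, map_ofNat] at hE hα ⊢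
  rw [Ψb, eRb]
  linear_combination (ub + vb) ^ 2 * hE + 2 * algebraMap Λ₂ Rb₂ Kinv * (ub_sq + vb_sq - hα)

/-- The explicit formula for Ψ_{τ(s)}^{2q}, with (xy)^{i−q} = (xy)^i·(xy)^{−q} and
K^{−q} written via the inverses xyInv of x·y and Kinv of K. -/
theorem psi_tau_s_even_power_formula
    (lam : ℝ) (hlam : 1 < lam) (h : ℝ) (hh : h = 1 / (6 * lam * (lam - 1)))
    (Kinv xyInv : Λ₂) (hK : K h * Kinv = 1) (hxy : x * y * xyInv = 1)
    (q : ℕ) (hq : 1 ≤ q) :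
    Ψb h ^ (2 * q) =
      algebraMap Λ₂ Rb₂ ((4 : Λ₂) ^ q * Kinv ^ q) *
        (algebraMap Λ₂ Rb₂ (∑ i ∈ Finset.range (q / 2 + 1),
            (q.choose (2 * i) : Λ₂) * α ^ (q - 2 * i) * ((x * y) ^ i * xyInv ^ q)) * 1 +
         algebraMap Λ₂ Rb₂ (∑ i ∈ Finset.range ((q - 1) / 2 + 1),
            (q.choose (2 * i + 1) : Λ₂) * α ^ (q - 2 * i - 1) * ((x * y) ^ (i + 1) * xyInv ^ q))
           * (ub * vb)) := by
  have hw : (ub * vb) ^ 2 = algebraMap Λ₂ Rb₂ xyInv := by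
    rw [eq_E_mul_E_of_mul_eq_one hxy, map_mul, ← ub_sq, ← vb_sq]
    exact mul_pow ub vb 2
  rw [pow_mul, Ψb_sq hK hxy, mul_one, ← mul_pow, map_pow]
  exact (mul_pow (algebraMap Λ₂ Rb₂ (4 * Kinv)) _ q).trans
    (congrArg (algebraMap Λ₂ Rb₂ (4 * Kinv) ^ q * ·)
      (add_pow_even_odd (B := Rb₂) (a := α) (w := ub * vb) hxy hw hq))

end
end
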